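/- Let ℱ be a fully Δ-capturing construction scheme whose type satisfies n_{k+1} ≥ 2^{m_k} for all k, let n ≥ 1, and let 𝔼_o = {o_α : α < ω₁} be defined as in the context. Then 𝔼_o, as a subset of the lexicographically ordered integer sequences ℤ^ω, is (2n+1)-entangled. -/

import Mathlib

noncomputable section

open scoped Classical

/-- The first uncountable ordinal. -/
def omegaOne : Ordinal := (Cardinal.aleph 1).ord

/-- A scheme type. -/
structure SchemeType where
  m : ℕ → ℕ
  n : ℕ → ℕ
  r : ℕ → ℕ
  m_zero : m 0 = 1
  n_ge : ∀ k, 2 ≤ n (k + 1)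
  r_lt : ∀ k, r (k + 1) < m k
  m_succ : ∀ k, m (k + 1) = r (k + 1) + (m k - r (k + 1)) * n (k + 1)

/-- `A` is an initial segment of `B`. -/
def InitSeg (A B : Finset Ordinal) : Prop := ∀ a ∈ A, ∀ b ∈ B, b < a → b ∈ A

/-- `D`, `R` form the canonical decomposition of `F ∈ ℱ_{k+1}`. -/
def IsDecomposition (T : SchemeType) (ℱ : Set (Finset Ordinal)) (k : ℕ)
    (F : Finset Ordinal) (D : ℕ → Finset Ordinal) (R : Finset Ordinal) : Prop :=
  (∀ i < T.n (k + 1), D i ∈ ℱ ∧ (D i).card = T.m k) ∧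
  F = (Finset.range (T.n (k + 1))).biUnion D ∧
  R.card = T.r (k + 1) ∧
  (∀ i < T.n (k + 1), ∀ j < T.n (k + 1), i ≠ j → D i ∩ D j = R) ∧
  (∀ i < T.n (k + 1), ∀ x ∈ R, ∀ y ∈ D i \ R, x < y) ∧
  (∀ i j, i < j → j < T.n (k + 1) → ∀ x ∈ D i \ R, ∀ y ∈ D j \ R, x < y)

/-- `ℱ` is a construction scheme of type `T` on `ω₁`. -/
structure IsConstructionScheme (T : SchemeType) (ℱ : Set (Finset Ordinal)) : Prop where
  nonempty_mem : ∀ F ∈ ℱ, F.Nonempty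
  mem_subset : ∀ F ∈ ℱ, ↑F ⊆ Set.Iio omegaOne
  cofinal : ∀ A : Finset Ordinal, ↑A ⊆ Set.Iio omegaOne → ∃ F ∈ ℱ, A ⊆ F
  card_eq : ∀ F ∈ ℱ, ∃ k, F.card = T.m k
  inter_initSeg : ∀ k : ℕ, ∀ E ∈ ℱ, ∀ F ∈ ℱ, E.card = T.m k → F.card = T.m k →
    InitSeg (E ∩ F) E ∧ InitSeg (E ∩ F) F
  decomp : ∀ k : ℕ, ∀ F ∈ ℱ, F.card = T.m (k + 1) → ∃ D R, IsDecomposition T ℱ k F D R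

/-- `ρ(α,β)`: least `k` such that `{α,β}` is included in a member of `ℱ_k`. -/
def rho (T : SchemeType) (ℱ : Set (Finset Ordinal)) (α β : Ordinal) : ℕ :=
  sInf {k | ∃ F ∈ ℱ, F.card = T.m k ∧ α ∈ F ∧ β ∈ F}

/-- `‖α‖_k`, the cardinality of `(α)_k \ {α}`. -/
def nrm (T : SchemeType) (ℱ : Set (Finset Ordinal)) (α : Ordinal) (k : ℕ) : ℕ :=
  Set.ncard {ξ : Ordinal | ξ < α ∧ rho T ℱ α ξ ≤ k}

/-- `Δ(α,β)`: least `k` with `‖α‖_k ≠ ‖β‖_k`. -/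
def deltaOrd (T : SchemeType) (ℱ : Set (Finset Ordinal)) (α β : Ordinal) : ℕ :=
  sInf {k | nrm T ℱ α k ≠ nrm T ℱ β k}

/-- `Ξ_α(k)`. -/
def Xi (T : SchemeType) (ℱ : Set (Finset Ordinal)) (α : Ordinal) (k : ℕ) : ℤ :=
  if k = 0 then 0
  else if h : ∃ i : ℕ, ∃ F ∈ ℱ, ∃ D R, F.card = T.m k ∧ α ∈ F ∧
      IsDecomposition T ℱ (k - 1) F D R ∧ i < T.n k ∧ α ∈ D i ∧ α ∉ R
  then (h.choose : ℤ) else -1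

/-- The `a`-th element of a finite set of ordinals, in increasing order. -/
def elt (A : Finset Ordinal) (a : ℕ) : Ordinal := (A.sort (· ≤ ·)).getD a 0

/-- The family `⟨D_0, …, D_{j-1}⟩` is Δ-captured at level `l`. -/
def DeltaCapturedFam (T : SchemeType) (ℱ : Set (Finset Ordinal)) (j : ℕ)
    (D : ℕ → Finset Ordinal) (l : ℕ) : Prop :=
  ∃ R : Finset Ordinal,
    (∀ i < j, ∀ i' < j, (D i).card = (D i').card) ∧
    (∀ i < j, ∀ i' < j, i ≠ i' → D i ∩ D i' = R) ∧
    (∀ i < j, ∀ x ∈ R, ∀ y ∈ D i \ R, x < y) ∧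
    (∀ i i', i < i' → i' < j → ∀ x ∈ D i \ R, ∀ y ∈ D i' \ R, x < y) ∧
    (∀ i < j, ∀ a < R.card, Xi T ℱ (elt (D i) a) l = -1) ∧
    (∀ i < j, ∀ a, R.card ≤ a → a < (D i).card → Xi T ℱ (elt (D i) a) l = (i : ℤ)) ∧
    (∀ i < j, ∀ i' < j, i ≠ i' → ∀ a, R.card ≤ a → a < (D i).card →
      deltaOrd T ℱ (elt (D i) a) (elt (D i') a) = l)

/-- The family `⟨D_0, …, D_{j-1}⟩` is captured at level `l`. -/
def CapturedFam (T : SchemeType) (ℱ : Set (Finset Ordinal)) (j : ℕ)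
    (D : ℕ → Finset Ordinal) (l : ℕ) : Prop :=
  DeltaCapturedFam T ℱ j D l ∧
  ∀ i < j, ∀ i' < j, i ≠ i' → ∀ a, (D i ∩ D i').card ≤ a → a < (D i).card →
    rho T ℱ (elt (D i) a) (elt (D i') a) = l

/-- The ordered pair `⟨A, B⟩`, as a family. -/
def pairFam (A B : Finset Ordinal) : ℕ → Finset Ordinal := fun i => if i = 0 then A else B

/-- A pair of ordinals `α < β` is captured at level `l`, i.e. `⟨{α},{β}⟩` is. -/
def CapturedPair (T : SchemeType) (ℱ : Set (Finset Ordinal)) (α β : Ordinal) (l : ℕ) : Prop :=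
  α < β ∧ Xi T ℱ α l = 0 ∧ Xi T ℱ β l = 1 ∧ deltaOrd T ℱ α β = l ∧ rho T ℱ α β = l

/-- `ℱ` is a 2-Δ-capturing scheme. -/
def TwoDeltaCapturing (T : SchemeType) (ℱ : Set (Finset Ordinal)) : Prop :=
  ∀ 𝒮 : Set (Finset Ordinal), (∀ A ∈ 𝒮, A.Nonempty ∧ ↑A ⊆ Set.Iio omegaOne) →
    ¬ 𝒮.Countable →
    {l : ℕ | ∃ A ∈ 𝒮, ∃ B ∈ 𝒮, A ≠ B ∧ DeltaCapturedFam T ℱ 2 (pairFam A B) l}.Infinite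

/-- `ℱ` is a 2-capturing scheme. -/
def TwoCapturing (T : SchemeType) (ℱ : Set (Finset Ordinal)) : Prop :=
  ∀ 𝒮 : Set (Finset Ordinal), (∀ A ∈ 𝒮, A.Nonempty ∧ ↑A ⊆ Set.Iio omegaOne) →
    ¬ 𝒮.Countable →
    {l : ℕ | ∃ A ∈ 𝒮, ∃ B ∈ 𝒮, A ≠ B ∧ CapturedFam T ℱ 2 (pairFam A B) l}.Infinite

/-- `ℱ` is a fully Δ-capturing scheme. -/
def FullyDeltaCapturing (T : SchemeType) (ℱ : Set (Finset Ordinal)) : Prop :=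
  ∀ 𝒮 : Set (Finset Ordinal), (∀ A ∈ 𝒮, A.Nonempty ∧ ↑A ⊆ Set.Iio omegaOne) →
    ¬ 𝒮.Countable →
    {l : ℕ | ∃ D : ℕ → Finset Ordinal, (∀ i < T.n l, D i ∈ 𝒮) ∧
      (∀ i < T.n l, ∀ i' < T.n l, i ≠ i' → D i ≠ D i') ∧
      DeltaCapturedFam T ℱ (T.n l) D l}.Infinite

/-- `E` is an `n`-entangled subset of the linear order `X`. -/
def IsNEntangled {X : Type*} [LinearOrder X] (E : Set X) (n : ℕ) : Prop :=
  ¬ E.Countable ∧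
  ∀ τ : Fin n → Fin 2, ∀ 𝒜 : Set (Fin n → X),
    (∀ a ∈ 𝒜, StrictMono a ∧ ∀ i, a i ∈ E) →
    (𝒜.Pairwise fun a b => ∀ i j, a i ≠ b j) →
    ¬ 𝒜.Countable →
    ∃ a ∈ 𝒜, ∃ b ∈ 𝒜, a ≠ b ∧ ∀ i, (a i < b i ↔ τ i = 0)


/-- The sequence `e_α` (depending on a parameter `nn` and the chosen enumerations `C`). -/
def eSeq (T : SchemeType) (ℱ : Set (Finset Ordinal)) (C : ℕ → ℕ → Finset ℕ) (nn : ℕ)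
    (α : Ordinal) : ℕ → ℤ := fun k =>
  if Xi T ℱ α k ≤ 0 then 0
  else if nrm T ℱ α (k - 1) ∈ C (k - 1) (Xi T ℱ α k).toNat ∨
      ((C (k - 1) (Xi T ℱ α k).toNat).card = nn ∧
        ∀ c ∈ C (k - 1) (Xi T ℱ α k).toNat, nrm T ℱ α (k - 1) < c)
  then Xi T ℱ α k
  else -(Xi T ℱ α k)

/-- The sequence `o_α` (depending on the chosen enumerations `C`). -/
def oSeq (T : SchemeType) (ℱ : Set (Finset Ordinal)) (C : ℕ → ℕ → Finset ℕ)
    (α : Ordinal) : ℕ → ℤ := fun k =>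
  if Xi T ℱ α k ≤ 0 then 0
  else if nrm T ℱ α (k - 1) ∈ C (k - 1) (Xi T ℱ α k).toNat
  then Xi T ℱ α k
  else -(Xi T ℱ α k)

/-- `C` is an enumeration `⟨C^k_i⟩_{0<i<n_{k+1}}` (possibly with repetitions) of all subsets of
`m_k ∖ r_{k+1}` of cardinality at most `nn`. -/
def IsGoodEnum (T : SchemeType) (nn : ℕ) (C : ℕ → ℕ → Finset ℕ) : Prop :=
  (∀ k, ∀ i, 0 < i → i < T.n (k + 1) →
    C k i ⊆ Finset.Ico (T.r (k + 1)) (T.m k) ∧ (C k i).card ≤ nn) ∧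
  (∀ k, ∀ s : Finset ℕ, s ⊆ Finset.Ico (T.r (k + 1)) (T.m k) → s.card ≤ nn →
    ∃ i, 0 < i ∧ i < T.n (k + 1) ∧ C k i = s)

theorem SchemeType.strictMono_m (T : SchemeType) : StrictMono T.m := by
  refine strictMono_nat_of_lt_succ fun k => ?_
  have h1 := T.r_lt k
  have h2 := T.n_ge k
  have h3 := T.m_succ k
  obtain ⟨d, hd⟩ := Nat.exists_eq_add_of_lt h1
  have h4 : T.m k - T.r (k + 1) = d + 1 := by omega
  rw [h4] at h3
  nlinarith

/-- An uncountable set has an uncountable fiber under any map with countable image. -/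
theorem exists_uncountable_fiber {X Y : Type*} {A : Set X} (hA : ¬ A.Countable) (g : X → Y)
    (hg : (g '' A).Countable) : ∃ y, ¬ {x ∈ A | g x = y}.Countable := by
  by_contra! h
  refine hA ((hg.biUnion fun y _ => h y).mono fun x hx => ?_)
  simp only [Set.mem_iUnion]
  exact ⟨g x, ⟨x, hx, rfl⟩, hx, rfl⟩

theorem natCast_lt_omegaOne (n : ℕ) : (n : Ordinal) < omegaOne := by
  rw [omegaOne, Cardinal.lt_ord, Ordinal.card_nat]
  exact (Cardinal.natCast_lt_aleph0).trans_le (Cardinal.aleph0_le_aleph 1)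

theorem not_countable_Iio_omegaOne : ¬ (Set.Iio omegaOne).Countable := by
  rw [← Cardinal.le_aleph0_iff_set_countable, Cardinal.mk_Iio_ordinal, omegaOne,
    Cardinal.card_ord, Cardinal.lift_le_aleph0, not_le, ← Cardinal.aleph_zero]
  exact Cardinal.aleph_lt_aleph.2 zero_lt_one

theorem exists_elt_eq {A : Finset Ordinal} {x : Ordinal} (hx : x ∈ A) :
    ∃ a < A.card, elt A a = x := by
  obtain ⟨a, ha, h⟩ := List.mem_iff_getElem.1 ((Finset.mem_sort (· ≤ ·)).2 hx)
  refine ⟨a, by simpa using ha, ?_⟩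
  rw [elt, List.getD_eq_getElem _ _ ha, h]

theorem nrm_eq_of_lt_deltaOrd {T : SchemeType} {ℱ : Set (Finset Ordinal)} {α β : Ordinal} {k : ℕ}
    (h : k < deltaOrd T ℱ α β) : nrm T ℱ α k = nrm T ℱ β k :=
  not_not.1 (Nat.notMem_of_lt_sInf h)

namespace IsDecomposition

variable {T : SchemeType} {ℱ : Set (Finset Ordinal)} {k : ℕ} {F R : Finset Ordinal}
  {D : ℕ → Finset Ordinal}

theorem mem_iff (h : IsDecomposition T ℱ k F D R) {x : Ordinal} :
    x ∈ F ↔ ∃ i < T.n (k + 1), x ∈ D i := by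
  rw [h.2.1]; simp

theorem root_subset (h : IsDecomposition T ℱ k F D R) {i : ℕ} (hi : i < T.n (k + 1)) :
    R ⊆ D i := by
  have h2 := T.n_ge k
  obtain ⟨j, hj, hij⟩ : ∃ j < T.n (k + 1), i ≠ j := by
    rcases Nat.eq_zero_or_pos i with rfl | h0
    · exact ⟨1, by omega, by omega⟩
    · exact ⟨0, by omega, by omega⟩
  rw [← h.2.2.2.1 i hi j hj hij]
  exact Finset.inter_subset_left

theorem card_sdiff (h : IsDecomposition T ℱ k F D R) {i : ℕ} (hi : i < T.n (k + 1)) :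
    (D i \ R).card = T.m k - T.r (k + 1) := by
  rw [Finset.card_sdiff_of_subset (h.root_subset hi), (h.1 i hi).2, h.2.2.1]

theorem card_filter_lt_of_mem_root (h : IsDecomposition T ℱ k F D R) {α : Ordinal} (hα : α ∈ R) :
    (F.filter (· < α)).card < T.r (k + 1) := by
  rw [← h.2.2.1]
  refine Finset.card_lt_card ((Finset.ssubset_iff_of_subset fun y hy => ?_).2 ⟨α, hα, by simp⟩)
  obtain ⟨hyF, hlt⟩ := Finset.mem_filter.1 hy
  obtain ⟨i, hi, hyi⟩ := h.mem_iff.1 hyF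
  by_contra hyR
  exact lt_asymm hlt (h.2.2.2.2.1 i hi α hα y (Finset.mem_sdiff.2 ⟨hyi, hyR⟩))

theorem card_filter_lt (h : IsDecomposition T ℱ k F D R) {i : ℕ} (hi : i < T.n (k + 1))
    {α : Ordinal} (hα : α ∈ D i) (hαR : α ∉ R) :
    ∃ e < T.m k - T.r (k + 1),
      (F.filter (· < α)).card = T.r (k + 1) + i * (T.m k - T.r (k + 1)) + e := by
  have hαi : α ∈ D i \ R := Finset.mem_sdiff.2 ⟨hα, hαR⟩
  refine ⟨((D i \ R).filter (· < α)).card, ?_, ?_⟩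
  · rw [← h.card_sdiff hi]
    exact Finset.card_lt_card
      ((Finset.ssubset_iff_of_subset (Finset.filter_subset _ _)).2 ⟨α, hαi, by simp⟩)
  have hdisj : ∀ a < T.n (k + 1), ∀ b < T.n (k + 1), a ≠ b → Disjoint (D a \ R) (D b \ R) := by
    intro a ha b hb hab
    rw [Finset.disjoint_left]
    intro x hxa hxb
    rw [Finset.mem_sdiff] at hxa hxb
    exact hxa.2 (h.2.2.2.1 a ha b hb hab ▸ Finset.mem_inter.2 ⟨hxa.1, hxb.1⟩)
  have key : F.filter (· < α) =
      (R ∪ (Finset.range i).biUnion fun j => D j \ R) ∪ (D i \ R).filter (· < α) := by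
    ext y
    simp only [Finset.mem_filter, Finset.mem_union, Finset.mem_biUnion, Finset.mem_range]
    constructor
    · rintro ⟨hyF, hlt⟩
      obtain ⟨j, hj, hyj⟩ := h.mem_iff.1 hyF
      by_cases hyR : y ∈ R
      · exact Or.inl (Or.inl hyR)
      have hy : y ∈ D j \ R := Finset.mem_sdiff.2 ⟨hyj, hyR⟩
      rcases lt_trichotomy j i with hji | rfl | hij
      · exact Or.inl (Or.inr ⟨j, hji, hy⟩)
      · exact Or.inr ⟨hy, hlt⟩
      · exact absurd hlt (h.2.2.2.2.2 i j hij hj α hαi y hy).not_gt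
    · rintro ((hyR | ⟨j, hj, hy⟩) | ⟨hy, hlt⟩)
      · exact ⟨h.mem_iff.2 ⟨i, hi, h.root_subset hi hyR⟩, h.2.2.2.2.1 i hi y hyR α hαi⟩
      · exact ⟨h.mem_iff.2 ⟨j, hj.trans hi, (Finset.mem_sdiff.1 hy).1⟩,
          h.2.2.2.2.2 j i hj hi y hy α hαi⟩
      · exact ⟨h.mem_iff.2 ⟨i, hi, (Finset.mem_sdiff.1 hy).1⟩, hlt⟩
  rw [key, Finset.card_union_of_disjoint, Finset.card_union_of_disjoint, Finset.card_biUnion,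
    Finset.sum_congr rfl (g := fun _ => T.m k - T.r (k + 1)), Finset.sum_const, Finset.card_range,
    smul_eq_mul, h.2.2.1]
  · intro j hj
    exact h.card_sdiff ((Finset.mem_range.1 hj).trans hi)
  · intro a ha b hb hab
    exact hdisj a ((Finset.mem_range.1 ha).trans hi) b ((Finset.mem_range.1 hb).trans hi) hab
  · rw [Finset.disjoint_biUnion_right]
    exact fun j _ => Finset.disjoint_sdiff
  · refine Finset.disjoint_of_subset_right (Finset.filter_subset _ _) ?_
    rw [Finset.disjoint_union_left, Finset.disjoint_biUnion_left]
    exact ⟨Finset.disjoint_sdiff, fun j hj => hdisj j ((Finset.mem_range.1 hj).trans hi) i hi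
      (Finset.mem_range.1 hj).ne⟩

end IsDecomposition

namespace IsConstructionScheme

variable {T : SchemeType} {ℱ : Set (Finset Ordinal)}

theorem mem_of_lt_of_le (hS : IsConstructionScheme T ℱ) {j k : ℕ} (hjk : j ≤ k)
    {G F : Finset Ordinal} (hG : G ∈ ℱ) (hGc : G.card = T.m j) (hF : F ∈ ℱ) (hFc : F.card = T.m k)
    {x y : Ordinal} (hxF : x ∈ F) (hxG : x ∈ G) (hyG : y ∈ G) (hyx : y < x) : y ∈ F := by
  induction k, hjk using Nat.le_induction generalizing F with
  | base =>
    exact (Finset.mem_inter.1 ((hS.inter_initSeg j G hG F hF hGc hFc).1 x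
      (Finset.mem_inter.2 ⟨hxG, hxF⟩) y hyG hyx)).2
  | succ k _ ih =>
    obtain ⟨D, R, h⟩ := hS.decomp k F hF hFc
    obtain ⟨i, hi, hx⟩ := h.mem_iff.1 hxF
    exact h.mem_iff.2 ⟨i, hi, ih (h.1 i hi).1 (h.1 i hi).2 hx⟩

theorem exists_superset_level_ge (hS : IsConstructionScheme T ℱ) {A : Finset Ordinal}
    (hA : ↑A ⊆ Set.Iio omegaOne) (k : ℕ) :
    ∃ k' ≥ k, ∃ F ∈ ℱ, F.card = T.m k' ∧ A ⊆ F := by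
  let B : Finset Ordinal := (Finset.range (T.m k)).image (fun n : ℕ => (n : Ordinal))
  have hB : B.card = T.m k := by
    rw [Finset.card_image_of_injective _ Nat.cast_injective, Finset.card_range]
  obtain ⟨F, hF, hsub⟩ := hS.cofinal (A ∪ B) (by
    intro x hx
    rcases Finset.mem_union.1 (Finset.mem_coe.1 hx) with h | h
    · exact hA h
    · obtain ⟨n, -, rfl⟩ := Finset.mem_image.1 h
      exact natCast_lt_omegaOne n)
  obtain ⟨k', hk'⟩ := hS.card_eq F hF
  refine ⟨k', ?_, F, hF, hk', Finset.subset_union_left.trans hsub⟩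
  rw [ge_iff_le, ← T.strictMono_m.le_iff_le, ← hk', ← hB]
  exact Finset.card_le_card (Finset.subset_union_right.trans hsub)

theorem exists_superset_level (hS : IsConstructionScheme T ℱ) {A : Finset Ordinal}
    (hA : ↑A ⊆ Set.Iio omegaOne) (hne : A.Nonempty) {k : ℕ}
    (hinit : ∀ k' ≥ k, ∀ F ∈ ℱ, F.card = T.m k' → ∀ x ∈ A, x ∈ F → ∀ y ∈ A, y < x → y ∈ F) :
    ∃ F ∈ ℱ, F.card = T.m k ∧ A ⊆ F := by
  obtain ⟨k', hk', F, hF, hFc, hAF⟩ := hS.exists_superset_level_ge hA k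
  induction k', hk' using Nat.le_induction generalizing F with
  | base => exact ⟨F, hF, hFc, hAF⟩
  | succ k' hk' ih =>
    obtain ⟨D, R, h⟩ := hS.decomp k' F hF hFc
    obtain ⟨i, hi, hmax⟩ := h.mem_iff.1 (hAF (A.max'_mem hne))
    refine ih (D i) (h.1 i hi).1 (h.1 i hi).2 fun y hy => ?_
    rcases (A.le_max' y hy).eq_or_lt with he | hlt
    · rwa [he]
    · exact hinit k' hk' (D i) (h.1 i hi).1 (h.1 i hi).2 _ (A.max'_mem hne) hmax y hy hlt

theorem exists_superset_level_of_le (hS : IsConstructionScheme T ℱ) {A G : Finset Ordinal}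
    (hne : A.Nonempty) {j k : ℕ} (hjk : j ≤ k) (hG : G ∈ ℱ) (hGc : G.card = T.m j)
    (hAG : A ⊆ G) : ∃ F ∈ ℱ, F.card = T.m k ∧ A ⊆ F :=
  hS.exists_superset_level ((Finset.coe_subset.2 hAG).trans (hS.mem_subset G hG)) hne
    fun _ hk' _ hF hFc _ hx hxF _ hy hyx =>
      hS.mem_of_lt_of_le (hjk.trans hk') hG hGc hF hFc hxF (hAG hx) (hAG hy) hyx

theorem exists_mem_level (hS : IsConstructionScheme T ℱ) {α : Ordinal} (hα : α < omegaOne)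
    (k : ℕ) : ∃ F ∈ ℱ, F.card = T.m k ∧ α ∈ F := by
  obtain ⟨F, hF, hFc, h⟩ := hS.exists_superset_level (A := {α}) (k := k) (by simpa using hα)
    (Finset.singleton_nonempty α) (by
      intro k' _ F _ _ x hx _ y hy hyx
      rw [Finset.mem_singleton] at hx hy
      exact absurd hyx (by rw [hx, hy]; exact lt_irrefl _))
  exact ⟨F, hF, hFc, Finset.singleton_subset_iff.1 h⟩

theorem nrm_eq_card_filter (hS : IsConstructionScheme T ℱ) {α : Ordinal} {k : ℕ}
    {F : Finset Ordinal} (hF : F ∈ ℱ) (hFc : F.card = T.m k) (hα : α ∈ F) :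
    nrm T ℱ α k = (F.filter (· < α)).card := by
  rw [nrm, ← Set.ncard_coe_finset]
  congr 1
  ext ξ
  simp only [Set.mem_ofPred_eq, Finset.coe_filter]
  rw [and_comm]
  refine and_congr_left fun hξ => ⟨fun h => ?_, fun h => Nat.sInf_le ⟨F, hF, hFc, hα, h⟩⟩
  have hne : {k | ∃ F ∈ ℱ, F.card = T.m k ∧ α ∈ F ∧ ξ ∈ F}.Nonempty := by
    have hα' : α < omegaOne := hS.mem_subset F hF hα
    obtain ⟨k', -, G, hG, hGc, h⟩ := hS.exists_superset_level_ge (A := {α, ξ}) (by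
      intro x hx
      simp only [Finset.coe_insert, Finset.coe_singleton, Set.mem_insert_iff,
        Set.mem_singleton_iff] at hx
      rcases hx with rfl | rfl
      · exact hα'
      · exact hξ.trans hα') 0
    exact ⟨k', G, hG, hGc, h (by simp), h (by simp)⟩
  obtain ⟨G, hG, hGc, hαG, hξG⟩ := Nat.sInf_mem hne
  exact hS.mem_of_lt_of_le h hG hGc hF hFc hα hαG hξG hξ

theorem nrm_injOn (hS : IsConstructionScheme T ℱ) {k : ℕ} {F : Finset Ordinal} (hF : F ∈ ℱ)
    (hFc : F.card = T.m k) : Set.InjOn (fun α => nrm T ℱ α k) F := by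
  have key : ∀ α ∈ F, ∀ β ∈ F, α < β → nrm T ℱ α k < nrm T ℱ β k := by
    intro α hα β hβ hlt
    rw [hS.nrm_eq_card_filter hF hFc hα, hS.nrm_eq_card_filter hF hFc hβ]
    refine Finset.card_lt_card ((Finset.ssubset_iff_of_subset ?_).2 ⟨α, ?_, by simp⟩)
    · exact Finset.monotone_filter_right _ fun x _ hx => lt_trans hx hlt
    · simp [hα, hlt]
  intro α hα β hβ h
  rcases lt_trichotomy α β with hlt | he | hlt
  · exact absurd h (key α hα β hβ hlt).ne
  · exact he
  · exact absurd h (key β hβ α hα hlt).ne'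

theorem Xi_succ (hS : IsConstructionScheme T ℱ) {α : Ordinal} (hα : α < omegaOne) (k : ℕ) :
    Xi T ℱ α (k + 1) = if nrm T ℱ α (k + 1) < T.r (k + 1) then -1
      else (((nrm T ℱ α (k + 1) - T.r (k + 1)) / (T.m k - T.r (k + 1)) : ℕ) : ℤ) := by
  rw [Xi, if_neg k.succ_ne_zero]
  split_ifs with h h' h'
  · obtain ⟨F, hF, D, R, hFc, hαF, hd, hi, hαi, hαR⟩ := h.choose_spec
    rw [Nat.add_sub_cancel] at hd
    obtain ⟨e, -, he⟩ := hd.card_filter_lt hi hαi hαR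
    rw [hS.nrm_eq_card_filter hF hFc hαF, he] at h'
    omega
  · obtain ⟨F, hF, D, R, hFc, hαF, hd, hi, hαi, hαR⟩ := h.choose_spec
    rw [Nat.add_sub_cancel] at hd
    obtain ⟨e, hlt, he⟩ := hd.card_filter_lt hi hαi hαR
    rw [hS.nrm_eq_card_filter hF hFc hαF, he, add_assoc, Nat.add_sub_cancel_left, mul_comm,
      Nat.mul_add_div (by omega), Nat.div_eq_of_lt hlt, add_zero]
  · rfl
  · obtain ⟨F, hF, hFc, hαF⟩ := hS.exists_mem_level hα (k + 1)
    obtain ⟨D, R, hd⟩ := hS.decomp k F hF hFc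
    obtain ⟨i, hi, hαi⟩ := hd.mem_iff.1 hαF
    by_cases hαR : α ∈ R
    · rw [hS.nrm_eq_card_filter hF hFc hαF] at h'
      exact absurd (hd.card_filter_lt_of_mem_root hαR) h'
    · exact absurd ⟨i, F, hF, D, R, hFc, hαF, hd, hi, hαi, hαR⟩ h

theorem Xi_eq_of_nrm_eq (hS : IsConstructionScheme T ℱ) {α β : Ordinal} (hα : α < omegaOne)
    (hβ : β < omegaOne) {k : ℕ} (h : nrm T ℱ α k = nrm T ℱ β k) : Xi T ℱ α k = Xi T ℱ β k := by
  cases k with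
  | zero => simp [Xi]
  | succ k => rw [hS.Xi_succ hα, hS.Xi_succ hβ, h]

theorem nrm_mem_Ico (hS : IsConstructionScheme T ℱ) {α : Ordinal} {k : ℕ}
    (h : 0 ≤ Xi T ℱ α (k + 1)) : nrm T ℱ α k ∈ Finset.Ico (T.r (k + 1)) (T.m k) := by
  rw [Xi, if_neg k.succ_ne_zero] at h
  split_ifs at h with hex
  · obtain ⟨i, F, hF, D, R, hFc, hαF, hd, hi, hαi, hαR⟩ := hex
    rw [Nat.add_sub_cancel] at hd
    rw [hS.nrm_eq_card_filter (hd.1 i hi).1 (hd.1 i hi).2 hαi, Finset.mem_Ico, ← hd.2.2.1,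
      ← (hd.1 i hi).2]
    refine ⟨Finset.card_le_card fun x hx => ?_, Finset.card_lt_card
      ((Finset.ssubset_iff_of_subset (Finset.filter_subset _ _)).2 ⟨α, hαi, by simp⟩)⟩
    exact Finset.mem_filter.2 ⟨hd.root_subset hi hx,
      hd.2.2.2.2.1 i hi x hx α (Finset.mem_sdiff.2 ⟨hαi, hαR⟩)⟩
  · omega

theorem oSeq_eq_of_lt_deltaOrd (hS : IsConstructionScheme T ℱ) (C : ℕ → ℕ → Finset ℕ)
    {α β : Ordinal} (hα : α < omegaOne) (hβ : β < omegaOne) {k : ℕ}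
    (h : k < deltaOrd T ℱ α β) : oSeq T ℱ C α k = oSeq T ℱ C β k := by
  rw [oSeq, oSeq, hS.Xi_eq_of_nrm_eq hα hβ (nrm_eq_of_lt_deltaOrd h),
    nrm_eq_of_lt_deltaOrd (lt_of_le_of_lt (Nat.sub_le k 1) h)]

end IsConstructionScheme

theorem toLex_lt_toLex_of_eq_of_lt {x y : ℕ → ℤ} {l : ℕ} (h : ∀ k < l, x k = y k)
    (hl : x l < y l) : toLex x < toLex y :=
  ⟨l, h, hl⟩

section Sequences

variable {T : SchemeType} {ℱ : Set (Finset Ordinal)} {C : ℕ → ℕ → Finset ℕ} {α : Ordinal} {k : ℕ}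

theorem oSeq_of_Xi_eq_zero (h : Xi T ℱ α k = 0) : oSeq T ℱ C α k = 0 := by
  simp [oSeq, h]

theorem oSeq_succ_of_mem {i : ℕ} (hi : 0 < i) (h : Xi T ℱ α (k + 1) = i)
    (hmem : nrm T ℱ α k ∈ C k i) : oSeq T ℱ C α (k + 1) = i := by
  simp [oSeq, h, hmem, hi.ne']

theorem oSeq_succ_of_notMem {i : ℕ} (hi : 0 < i) (h : Xi T ℱ α (k + 1) = i)
    (hmem : nrm T ℱ α k ∉ C k i) : oSeq T ℱ C α (k + 1) = -i := by
  simp [oSeq, h, hmem, hi.ne']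

end Sequences

/-- An uncountable family of finite sets contains a Δ-captured family of size `n_l` at some
level `l` above any prescribed bound. -/
theorem FullyDeltaCapturing.exists_captured {T : SchemeType} {ℱ : Set (Finset Ordinal)}
    (hcap : FullyDeltaCapturing T ℱ) {ι : Type*} {B : Set ι} (hB : ¬ B.Countable)
    {s : ι → Finset Ordinal} (hinj : Set.InjOn s B)
    (hs : ∀ b ∈ B, (s b).Nonempty ∧ ↑(s b) ⊆ Set.Iio omegaOne) (K : ℕ) :
    ∃ l, K ≤ l ∧ ∃ b : ℕ → ι, (∀ i < T.n (l + 1), b i ∈ B) ∧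
      (∀ i < T.n (l + 1), ∀ i' < T.n (l + 1), i ≠ i' → b i ≠ b i') ∧
      DeltaCapturedFam T ℱ (T.n (l + 1)) (fun i => s (b i)) (l + 1) := by
  obtain ⟨l, ⟨D, hD, hne, hfam⟩, hl⟩ := (hcap (s '' B) (Set.forall_mem_image.2 hs)
    fun h => hB (Set.countable_of_injective_of_countable_image hinj h)).exists_gt K
  obtain ⟨l, rfl⟩ := Nat.exists_eq_succ_of_ne_zero (Nat.ne_zero_of_lt hl)
  have : Nonempty ι := ⟨(hD 0 (zero_lt_two.trans_le (T.n_ge l))).choose⟩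
  choose! b hb hbD using hD
  refine ⟨l, Nat.lt_succ_iff.1 hl, b, hb, fun i hi i' hi' h he => hne i hi i' hi' h ?_, ?_⟩
  · rw [← hbD i hi, ← hbD i' hi', he]
  obtain ⟨R, h1, h2, h3, h4, h5, h6, h7⟩ := hfam
  refine ⟨R, fun i hi i' hi' => ?_, fun i hi i' hi' => ?_, fun i hi => ?_, fun i i' h hi' => ?_,
    fun i hi => ?_, fun i hi => ?_, fun i hi i' hi' => ?_⟩
  · simpa only [hbD i hi, hbD i' hi'] using h1 i hi i' hi'
  · simpa only [hbD i hi, hbD i' hi'] using h2 i hi i' hi'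
  · simpa only [hbD i hi] using h3 i hi
  · simpa only [hbD i (h.trans hi'), hbD i' hi'] using h4 i i' h hi'
  · simpa only [hbD i hi] using h5 i hi
  · simpa only [hbD i hi] using h6 i hi
  · simpa only [hbD i hi, hbD i' hi'] using h7 i hi i' hi'

/-- In a family of pairwise disjoint tuples of fixed order type, captured families separate the
coordinates: the tuples agree up to level `l`, with `Ξ` equal to the index in the family. -/
theorem exists_captured_tuples {T : SchemeType} {ℱ : Set (Finset Ordinal)}
    (hS : IsConstructionScheme T ℱ) (hcap : FullyDeltaCapturing T ℱ) {ι : Type*} {B : Set ι}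
    (hB : ¬ B.Countable) {N : ℕ} (hN : 0 < N) (f : ι → Fin N → Ordinal)
    (hf : ∀ a ∈ B, Function.Injective (f a) ∧ ∀ j, f a j < omegaOne)
    (hdisj : ∀ a ∈ B, ∀ b ∈ B, a ≠ b → ∀ i j, f a i ≠ f b j) :
    ∃ l, ∃ b : ℕ → ι, (∀ i < T.n (l + 1), b i ∈ B) ∧
      (∀ i < T.n (l + 1), ∀ i' < T.n (l + 1), i ≠ i' → b i ≠ b i') ∧
      (∀ i < T.n (l + 1), ∀ j, Xi T ℱ (f (b i) j) (l + 1) = i) ∧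
      (∀ i < T.n (l + 1), Function.Injective fun j => nrm T ℱ (f (b i) j) l) ∧
      (∀ i < T.n (l + 1), ∀ i' < T.n (l + 1), i ≠ i' → ∀ j,
        deltaOrd T ℱ (f (b i) j) (f (b i') j) = l + 1) := by
  have : Nonempty (Fin N) := ⟨⟨0, hN⟩⟩
  let s : ι → Finset Ordinal := fun a => Finset.univ.image (f a)
  have hmem : ∀ a j, f a j ∈ s a := fun a j => Finset.mem_image_of_mem _ (Finset.mem_univ j)
  have hsub : ∀ a ∈ B, ↑(s a) ⊆ Set.Iio omegaOne := by
    intro a ha x hx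
    obtain ⟨j, -, rfl⟩ := Finset.mem_image.1 (Finset.mem_coe.1 hx)
    exact (hf a ha).2 j
  have hcard : ∀ a ∈ B, (s a).card = N := fun a ha => by
    rw [Finset.card_image_of_injective _ (hf a ha).1, Finset.card_univ, Fintype.card_fin]
  have hne : ∀ a, (s a).Nonempty := fun a => Finset.univ_nonempty.image _
  choose p hpN hp using fun a j => exists_elt_eq (hmem a j)
  have hlev : ∀ a, ∃ k, a ∈ B → ∃ F ∈ ℱ, F.card = T.m k ∧ s a ⊆ F := fun a => by
    by_cases ha : a ∈ B
    · obtain ⟨k, -, h⟩ := hS.exists_superset_level_ge (hsub a ha) 0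
      exact ⟨k, fun _ => h⟩
    · exact ⟨0, fun h => absurd h ha⟩
  choose K hK using hlev
  obtain ⟨⟨q, k⟩, hB'⟩ := exists_uncountable_fiber hB (fun a => (p a, K a)) (Set.to_countable _)
  have hsdisj : ∀ a ∈ B, ∀ b ∈ B, a ≠ b → s a ∩ s b = ∅ := by
    intro a ha b hb hab
    rw [← Finset.disjoint_iff_inter_eq_empty, Finset.disjoint_left]
    intro x hxa hxb
    obtain ⟨i, -, rfl⟩ := Finset.mem_image.1 hxa
    obtain ⟨j, -, hj⟩ := Finset.mem_image.1 hxb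
    exact hdisj a ha b hb hab i j hj.symm
  obtain ⟨l, hl, b, hb, hbne, R, -, hR, -, -, -, hXi, hΔ⟩ := hcap.exists_captured hB' (s := s)
    (fun a ha b hb hab => by
      by_contra h
      have := hsdisj a ha.1 b hb.1 h
      rw [hab, Finset.inter_self] at this
      exact (hne b).ne_empty this)
    (fun a ha => ⟨hne a, hsub a ha.1⟩) k
  have h2 := T.n_ge l
  have hR0 : R = ∅ := by
    rw [← hR 0 (by omega) 1 (by omega) zero_ne_one]
    exact hsdisj _ (hb 0 (by omega)).1 _ (hb 1 (by omega)).1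
      (hbne 0 (by omega) 1 (by omega) zero_ne_one)
  have hq : ∀ i < T.n (l + 1), ∀ j, elt (s (b i)) (q j) = f (b i) j := by
    intro i hi j
    have h : p (b i) = q := congrArg Prod.fst (hb i hi).2
    rw [← h, hp]
  have hqlt : ∀ i < T.n (l + 1), ∀ j, q j < (s (b i)).card := by
    intro i hi j
    have h : p (b i) = q := congrArg Prod.fst (hb i hi).2
    rw [← h]
    exact hpN _ _
  refine ⟨l, b, fun i hi => (hb i hi).1, hbne, fun i hi j => ?_, fun i hi j j' h => ?_,
    fun i hi i' hi' h j => ?_⟩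
  · rw [← hq i hi]
    exact hXi i hi _ (by simp [hR0]) (hqlt i hi j)
  · have hk : K (b i) = k := congrArg Prod.snd (hb i hi).2
    obtain ⟨G, hG, hGc, hsG⟩ := hK (b i) (hb i hi).1
    obtain ⟨F, hF, hFc, hsF⟩ :=
      hS.exists_superset_level_of_le (hne (b i)) (hk.trans_le hl) hG hGc hsG
    exact (hf _ (hb i hi).1).1 (hS.nrm_injOn hF hFc (hsF (hmem _ j)) (hsF (hmem _ j')) h)
  · rw [← hq i hi, ← hq i' hi']
    exact hΔ i hi i' hi' h _ (by simp [hR0]) (hqlt i hi j)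

/-- The sequences `o_α` form an uncountable set. -/
theorem not_countable_image_oSeq {T : SchemeType} {ℱ : Set (Finset Ordinal)}
    (hS : IsConstructionScheme T ℱ) (hcap : FullyDeltaCapturing T ℱ) (C : ℕ → ℕ → Finset ℕ) :
    ¬ ((fun α => toLex (oSeq T ℱ C α)) '' Set.Iio omegaOne).Countable := by
  intro hcount
  obtain ⟨y, hy⟩ := exists_uncountable_fiber not_countable_Iio_omegaOne _ hcount
  obtain ⟨l, b, hb, -, hXi, -, -⟩ := exists_captured_tuples hS hcap hy one_pos (fun α _ => α)
    (fun α hα => ⟨Function.injective_of_subsingleton _, fun _ => hα.1⟩)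
    (fun α _ β _ h _ _ => h)
  have h2 := T.n_ge l
  have h0 := oSeq_of_Xi_eq_zero (C := C) (hXi 0 (by omega) 0)
  have h1 := hXi 1 (by omega) 0
  have heq : oSeq T ℱ C (b 0) = oSeq T ℱ C (b 1) :=
    toLex.injective ((hb 0 (by omega)).2.trans (hb 1 (by omega)).2.symm)
  rw [heq] at h0
  by_cases hc : nrm T ℱ (b 1) l ∈ C l 1
  · have := oSeq_succ_of_mem one_pos h1 hc
    rw [h0] at this
    norm_num at this
  · have := oSeq_succ_of_notMem one_pos h1 hc
    rw [h0] at this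
    norm_num at this

/-- A captured family of tuples realizes, against its first member, every pattern of signs with at
most `nn` coordinates that increase. -/
theorem exists_oSeq_lt_iff {T : SchemeType} {ℱ : Set (Finset Ordinal)}
    (hS : IsConstructionScheme T ℱ) {nn : ℕ} {C : ℕ → ℕ → Finset ℕ} (hC : IsGoodEnum T nn C)
    {N l : ℕ} {g : ℕ → Fin N → Ordinal} (hg : ∀ i < T.n (l + 1), ∀ j, g i j < omegaOne)
    (hXi : ∀ i < T.n (l + 1), ∀ j, Xi T ℱ (g i j) (l + 1) = i)
    (hinj : ∀ i < T.n (l + 1), Function.Injective fun j => nrm T ℱ (g i j) l)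
    (hΔ : ∀ i < T.n (l + 1), ∀ i' < T.n (l + 1), i ≠ i' → ∀ j,
      deltaOrd T ℱ (g i j) (g i' j) = l + 1) {P : Finset (Fin N)} (hP : P.card ≤ nn) :
    ∃ i, 0 < i ∧ i < T.n (l + 1) ∧ ∀ j,
      (j ∈ P → toLex (oSeq T ℱ C (g 0 j)) < toLex (oSeq T ℱ C (g i j))) ∧
      (j ∉ P → toLex (oSeq T ℱ C (g i j)) < toLex (oSeq T ℱ C (g 0 j))) := by
  have h0 : 0 < T.n (l + 1) := zero_lt_two.trans_le (T.n_ge l)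
  obtain ⟨i, hi0, hi, hCi⟩ := hC.2 l (P.image fun j => nrm T ℱ (g 0 j) l)
    (by
      intro x hx
      obtain ⟨j, -, rfl⟩ := Finset.mem_image.1 hx
      exact hS.nrm_mem_Ico (by rw [hXi 0 h0 j]; simp))
    (Finset.card_image_le.trans hP)
  have hmem : ∀ j, nrm T ℱ (g i j) l ∈ C l i ↔ j ∈ P := by
    intro j
    rw [hCi, nrm_eq_of_lt_deltaOrd (α := g i j) (β := g 0 j)
      (by rw [hΔ i hi 0 h0 hi0.ne']; exact l.lt_succ_self)]
    exact (hinj 0 h0).mem_finset_image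
  have hlow : ∀ j, ∀ k < l + 1, oSeq T ℱ C (g 0 j) k = oSeq T ℱ C (g i j) k := fun j k hk =>
    hS.oSeq_eq_of_lt_deltaOrd C (hg 0 h0 j) (hg i hi j) (by rwa [hΔ 0 h0 i hi hi0.ne])
  have hzero : ∀ j, oSeq T ℱ C (g 0 j) (l + 1) = 0 := fun j =>
    oSeq_of_Xi_eq_zero (hXi 0 h0 j)
  refine ⟨i, hi0, hi, fun j => ⟨fun hj => ?_, fun hj => ?_⟩⟩
  · refine toLex_lt_toLex_of_eq_of_lt (hlow j) ?_
    rw [hzero, oSeq_succ_of_mem hi0 (hXi i hi j) ((hmem j).2 hj)]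
    exact_mod_cast hi0
  · refine toLex_lt_toLex_of_eq_of_lt (fun k hk => (hlow j k hk).symm) ?_
    rw [hzero, oSeq_succ_of_notMem hi0 (hXi i hi j) (mt (hmem j).1 hj)]
    simpa using hi0

/-- If `ℱ` is a fully Δ-capturing construction scheme whose type satisfies `n_{k+1} ≥ 2^{m_k}`,
then `𝔼_o = {o_α : α < ω₁}` is `(2n+1)`-entangled as a subset of `ℤ^ω` with the lexicographic
order. -/
theorem stmt4 (T : SchemeType) (ℱ : Set (Finset Ordinal))
    (hS : IsConstructionScheme T ℱ) (hcap : FullyDeltaCapturing T ℱ)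
    (hgrow : ∀ k, 2 ^ T.m k ≤ T.n (k + 1))
    (nn : ℕ) (hn : 1 ≤ nn) (C : ℕ → ℕ → Finset ℕ) (hC : IsGoodEnum T nn C) :
    IsNEntangled ((fun α => toLex (oSeq T ℱ C α)) '' Set.Iio omegaOne) (2 * nn + 1) := by
  refine ⟨not_countable_image_oSeq hS hcap C, fun τ 𝒜 h𝒜 hdisj hunc => ?_⟩
  have hex : ∀ a : Fin (2 * nn + 1) → Lex (ℕ → ℤ), ∃ f : Fin (2 * nn + 1) → Ordinal,
      a ∈ 𝒜 → ∀ j, f j < omegaOne ∧ toLex (oSeq T ℱ C (f j)) = a j := by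
    intro a
    by_cases ha : a ∈ 𝒜
    · choose f hf using (h𝒜 a ha).2
      exact ⟨f, fun _ => hf⟩
    · exact ⟨fun _ => 0, fun h => absurd h ha⟩
  choose f hf using hex
  obtain ⟨l, b, hb, hbne, hXi, hinj, hΔ⟩ := exists_captured_tuples hS hcap hunc
    (Nat.succ_pos _) f
    (fun a ha => ⟨fun i j hij => (h𝒜 a ha).1.injective (by
      rw [← (hf a ha i).2, ← (hf a ha j).2, hij]), fun j => (hf a ha j).1⟩)
    (fun a ha b hb hab i j hij => hdisj ha hb hab i j (by
      rw [← (hf a ha i).2, ← (hf b hb j).2, hij]))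
  have h0 : 0 < T.n (l + 1) := zero_lt_two.trans_le (T.n_ge l)
  have key := fun P hP => exists_oSeq_lt_iff (P := P) hS hC
    (g := fun i => f (b i)) (fun i hi j => (hf _ (hb i hi) j).1) hXi hinj hΔ hP
  simp only [(hf _ (hb 0 h0) _).2] at key
  have hcard := Finset.card_filter_add_card_filter_not (s := Finset.univ) (fun j => τ j = 0)
  rw [Finset.card_univ, Fintype.card_fin] at hcard
  rcases le_or_gt (Finset.univ.filter fun j => τ j = 0).card nn with hP | hP
  · obtain ⟨i, hi0, hi, h⟩ := key _ hP
    refine ⟨b 0, hb 0 h0, b i, hb i hi, hbne 0 h0 i hi hi0.ne, fun j => ?_⟩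
    have hj := h j
    simp only [(hf _ (hb i hi) _).2, Finset.mem_filter_univ] at hj
    exact ⟨fun hlt => by_contra fun hτ => lt_asymm hlt (hj.2 hτ), hj.1⟩
  · obtain ⟨i, hi0, hi, h⟩ := key (Finset.univ.filter fun j => ¬ τ j = 0) (by omega)
    refine ⟨b i, hb i hi, b 0, hb 0 h0, hbne i hi 0 h0 hi0.ne', fun j => ?_⟩
    have hj := h j
    simp only [(hf _ (hb i hi) _).2, Finset.mem_filter_univ, not_not] at hj
    exact ⟨fun hlt => by_contra fun hτ => lt_asymm hlt (hj.1 hτ), hj.2⟩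

end
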